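/- Fix τ > 0, M > 2ζ(1+τ), ρ > 0, 0 < r < R₀, and let f ∈ H^∞(S_{R₀}) have zero mean value. Let u ∈ C^±_r satisfy ‖u‖_r < R₀ − r, so that E(u) := −Δu + ε·f∘(id+u) ∈ C_r is well defined, and set A := 1 + ∂_θ u. Then the mean value of A·E(u) vanishes: ⟨A·E(u)⟩ = 0 (as an element of C¹_hol(K_M, B_ρ)), where A·E(u) belongs to C_{r'} for every r' ∈ (0,r) and ⟨·⟩ denotes the 0-th Fourier coefficient in θ. -/

import Mathlib

open Complex Metric Set OnePoint

noncomputable section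

/-- Real Riemann zeta value `ζ(s) = Σ_{m≥1} m^{-s}` for real `s`. -/
def zetaR (s : ℝ) : ℝ := ∑' n : ℕ, 1 / (n + 1 : ℝ) ^ s

/-- The set `A_M^ℝ` of real `(2+τ)`-Diophantine numbers with constant `M`. -/
def AMR (τ M : ℝ) : Set ℝ :=
  {ω | ∀ n : ℤ, ∀ m : ℕ, 0 < m → 1 / (M * (m : ℝ) ^ (2 + τ)) ≤ |ω - n / m|}

/-- The complex extension `A_M^ℂ`. -/
def AMC (τ M : ℝ) : Set ℂ :=
  {ω | ∃ ω₀ ∈ AMR τ M, |ω₀ - ω.re| ≤ |ω.im|}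

/-- `E(ω) = e^{2πiω}`. -/
def Efn (ω : ℂ) : ℂ := Complex.exp (2 * Real.pi * Complex.I * ω)

/-- The compact set `K_M = E(A_M^ℂ) ∪ {0,∞}` in the Riemann sphere `Ĉ = ℂ ∪ {∞}`. -/
def KM (τ M : ℝ) : Set (OnePoint ℂ) :=
  (fun ω => ((Efn ω : ℂ) : OnePoint ℂ)) '' AMC τ M ∪ {((0 : ℂ) : OnePoint ℂ), ∞}

/-- The chart `ξ ↦ 1/ξ` of the Riemann sphere at `∞`. -/
def sphChart (ξ : ℂ) : OnePoint ℂ := if ξ = 0 then ∞ else ((ξ⁻¹ : ℂ) : OnePoint ℂ)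

/-- `K ∩ ℂ`, in the coordinate `q`. -/
def finPart (K : Set (OnePoint ℂ)) : Set ℂ := {q : ℂ | (q : OnePoint ℂ) ∈ K}
/-- `K̃ = {ξ : 1/ξ ∈ K}`, the set `K` read in the coordinate `ξ = 1/q`. -/
def infPart (K : Set (OnePoint ℂ)) : Set ℂ := {ξ : ℂ | sphChart ξ ∈ K}

variable {α : Type*} {B : Type*} [NormedAddCommGroup B] [NormedSpace ℂ B]

/-- Difference quotient error `Ω_{u,g}(q,q') = (u(q')−u(q))/(q'−q) − g(q)`,
for functions with values in a space of functions on `α`. -/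
def omegaF (u g : ℂ → α → B) (p : ℂ × ℂ) (a : α) : B :=
  if p.1 = p.2 then 0 else (p.2 - p.1)⁻¹ • (u p.2 a - u p.1 a) - g p.1 a

/-- Continuity on `K` for the sup-norm over `S` of the values. -/
def ContSup (K : Set ℂ) (S : Set α) (u : ℂ → α → B) : Prop :=
  ∀ q ∈ K, ∀ ε > (0 : ℝ), ∃ δ > (0 : ℝ), ∀ q' ∈ K, dist q' q < δ →
    ∀ a ∈ S, ‖u q' a - u q a‖ ≤ ε

/-- Continuity on `K × K` for the sup-norm over `S` of the values. -/
def ContSup2 (K : Set ℂ) (S : Set α) (F : ℂ × ℂ → α → B) : Prop :=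
  ∀ p ∈ K ×ˢ K, ∀ ε > (0 : ℝ), ∃ δ > (0 : ℝ), ∀ p' ∈ K ×ˢ K, dist p' p < δ →
    ∀ a ∈ S, ‖F p' a - F p a‖ ≤ ε

/-- `u` is `C¹`-holomorphic on `K ⊂ ℂ` with derivative `g`, with values in the
space of bounded functions on `S` (sup norm). -/
def FPair (K : Set ℂ) (S : Set α) (u g : ℂ → α → B) : Prop :=
  ContSup K S u ∧ ContSup K S g ∧ ContSup2 K S (omegaF u g)

def fn0 (K : Set ℂ) (S : Set α) (u : ℂ → α → B) : ℝ :=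
  sSup {x : ℝ | ∃ q ∈ K, ∃ a ∈ S, x = ‖u q a‖}
def fdel (K : Set ℂ) (S : Set α) (u : ℂ → α → B) : ℝ :=
  sSup {x : ℝ | ∃ p ∈ K ×ˢ K, ∃ a ∈ S, x = ‖u (Prod.snd p) a - u (Prod.fst p) a‖}
def fn2 (K : Set ℂ) (S : Set α) (u g : ℂ → α → B) : ℝ :=
  sSup {x : ℝ | ∃ p ∈ K ×ˢ K, ∃ a ∈ S, x = ‖omegaF u g p a‖}

/-- The `C¹_hol` norm `n₀ + max(sup‖φ'‖, sup‖δφ‖) + n₂` (one chart). -/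
def fNorm (K : Set ℂ) (S : Set α) (u g : ℂ → α → B) : ℝ :=
  fn0 K S u + max (fn0 K S g) (fdel K S u) + fn2 K S u g

def FBdd (K : Set ℂ) (S : Set α) (u g : ℂ → α → B) : Prop :=
  BddAbove {x : ℝ | ∃ q ∈ K, ∃ a ∈ S, x = ‖u q a‖} ∧
    BddAbove {x : ℝ | ∃ q ∈ K, ∃ a ∈ S, x = ‖g q a‖} ∧
    BddAbove {x : ℝ | ∃ p ∈ K ×ˢ K, ∃ a ∈ S, x = ‖omegaF u g p a‖}

/-- `C¹`-holomorphy on a subset `K` of the Riemann sphere: `C¹`-holomorphy in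
both charts `q` and `ξ = 1/q`, with chartwise derivatives `g` and `h`. -/
def SPair (K : Set (OnePoint ℂ)) (S : Set α) (u : OnePoint ℂ → α → B)
    (g h : ℂ → α → B) : Prop :=
  FPair (finPart K) S (fun q : ℂ => u (q : OnePoint ℂ)) g ∧
    FPair (infPart K) S (fun ξ : ℂ => u (sphChart ξ)) h

def SBdd (K : Set (OnePoint ℂ)) (S : Set α) (u : OnePoint ℂ → α → B)
    (g h : ℂ → α → B) : Prop :=
  FBdd (finPart K) S (fun q : ℂ => u (q : OnePoint ℂ)) g ∧
    FBdd (infPart K) S (fun ξ : ℂ => u (sphChart ξ)) h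

/-- The `C¹_hol(K,·)` norm for `K ⊂ Ĉ`: max of the norms in the two charts. -/
def sNorm (K : Set (OnePoint ℂ)) (S : Set α) (u : OnePoint ℂ → α → B)
    (g h : ℂ → α → B) : ℝ :=
  max (fNorm (finPart K) S (fun q : ℂ => u (q : OnePoint ℂ)) g)
    (fNorm (infPart K) S (fun ξ : ℂ => u (sphChart ξ)) h)

/-- The strip `S_r` (identified with `{x ∈ ℂ/ℤ : |Im x| < r}` via 1-periodicity). -/
def Strip (r : ℝ) : Set ℂ := {z : ℂ | |z.im| < r}

/-- `S_r × D_ρ`, the domain of the elements of `B_{r,ρ} = H^∞(S_r × D_ρ)`. -/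
def SD (r ρ : ℝ) : Set (ℂ × ℂ) := Strip r ×ˢ Metric.ball (0 : ℂ) ρ

/-- Membership of a value in `B_{r,ρ} = H^∞(S_r × D_ρ) = H^∞(S_r, B_ρ)`:
1-periodicity in `θ` and holomorphy on `S_r × D_ρ` (boundedness being part of
the `C¹_hol` data). -/
def ValHol (r ρ : ℝ) (v : ℂ × ℂ → ℂ) : Prop :=
  (∀ θ ε : ℂ, v (θ + 1, ε) = v (θ, ε)) ∧ DifferentiableOn ℂ v (SD r ρ)

/-- `u ∈ C_r = C¹_hol(K_M, H^∞(S_r, B_ρ))`, with chartwise derivative data `g, h`. -/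
def MemC (τ M r ρ : ℝ) (u : OnePoint ℂ → ℂ × ℂ → ℂ) (g h : ℂ → ℂ × ℂ → ℂ) : Prop :=
  SPair (KM τ M) (SD r ρ) u g h ∧ SBdd (KM τ M) (SD r ρ) u g h ∧
    ∀ q ∈ KM τ M, ValHol r ρ (u q)

/-- The norm `‖u‖_r` of `u ∈ C_r`, given its derivative data `g, h`. -/
def CNorm (τ M r ρ : ℝ) (u : OnePoint ℂ → ℂ × ℂ → ℂ) (g h : ℂ → ℂ × ℂ → ℂ) : ℝ :=
  sNorm (KM τ M) (SD r ρ) u g h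

/-- The `k`-th Fourier coefficient `φ̂_k(q) ∈ B_ρ` of `u(q) ∈ H^∞(S_r, B_ρ)`. -/
def fhat (u : OnePoint ℂ → ℂ × ℂ → ℂ) (k : ℤ) (q : OnePoint ℂ) (ε : ℂ) : ℂ :=
  ∫ t in (0:ℝ)..1, u q ((t : ℂ), ε) * Complex.exp (-(2 * Real.pi * Complex.I * k * t))

/-- `e_k(θ) = e^{2πikθ}`. -/
def ek (k : ℤ) (θ : ℂ) : ℂ := Complex.exp (2 * Real.pi * Complex.I * k * θ)

/-- `up = u⁺`, i.e. `up(q,θ) = Σ_k q^k û_k(q) e_k(θ)` on `K_M` (for `q = e^{2πiω}`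
this is `u(q, θ+ω)`). -/
def IsPlus (τ M r ρ : ℝ) (u up : OnePoint ℂ → ℂ × ℂ → ℂ) : Prop :=
  ∀ q : ℂ, (q : OnePoint ℂ) ∈ KM τ M → q ≠ 0 → ∀ θ ∈ Strip r,
    ∀ ε ∈ Metric.ball (0 : ℂ) ρ,
      HasSum (fun k : ℤ => q ^ k * fhat u k (q : OnePoint ℂ) ε * ek k θ)
        (up (q : OnePoint ℂ) (θ, ε))

/-- `um = u⁻`, i.e. `um(q,θ) = Σ_k q^{-k} û_k(q) e_k(θ)`. -/
def IsMinus (τ M r ρ : ℝ) (u um : OnePoint ℂ → ℂ × ℂ → ℂ) : Prop :=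
  ∀ q : ℂ, (q : OnePoint ℂ) ∈ KM τ M → q ≠ 0 → ∀ θ ∈ Strip r,
    ∀ ε ∈ Metric.ball (0 : ℂ) ρ,
      HasSum (fun k : ℤ => q ^ (-k) * fhat u k (q : OnePoint ℂ) ε * ek k θ)
        (um (q : OnePoint ℂ) (θ, ε))

/-- The derivative `∂_θ` acting on values. -/
def dth (v : OnePoint ℂ → ℂ × ℂ → ℂ) (q : OnePoint ℂ) (p : ℂ × ℂ) : ℂ :=
  deriv (fun t => v q (t, p.2)) p.1

/-- Real-symmetry (`u ∈ C_{r,ℝ}`): `conj(û_k(q)) = û_{-k}(1/q̄)` where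
`(conj ψ)(ε) = conj(ψ(ε̄))` in `B_ρ`. -/
def RealSym (τ M : ℝ) (u : OnePoint ℂ → ℂ × ℂ → ℂ) : Prop :=
  ∀ k : ℤ, ∀ q : ℂ, (q : OnePoint ℂ) ∈ KM τ M → q ≠ 0 → ∀ ε : ℂ,
    starRingEnd ℂ (fhat u k (q : OnePoint ℂ) (starRingEnd ℂ ε)) =
      fhat u (-k) (((((starRingEnd ℂ) q)⁻¹ : ℂ) : OnePoint ℂ)) ε

/-- `f ∈ C_r` (existence of `C¹`-holomorphic derivative data). -/
def InC (τ M r ρ : ℝ) (f : OnePoint ℂ → ℂ × ℂ → ℂ) : Prop :=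
  ∃ g h : ℂ → ℂ × ℂ → ℂ, MemC τ M r ρ f g h

lemma isOpen_strip (r : ℝ) : IsOpen (Strip r) :=
  isOpen_lt (by fun_prop) continuous_const

lemma convex_strip (r : ℝ) : Convex ℝ (Strip r) := by
  have : Strip r = Complex.im ⁻¹' Set.Ioo (-r) r := by
    ext z
    simp [Strip, abs_lt]
  rw [this]
  exact (convex_Ioo _ _).linear_preimage Complex.imLm

lemma ofReal_mem_strip {r : ℝ} (hr : 0 < r) (t : ℝ) : (t : ℂ) ∈ Strip r := by
  simpa [Strip] using hr

lemma continuous_comp_ofReal {r : ℝ} (hr : 0 < r) {U : ℂ → ℂ}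
    (hU : DifferentiableOn ℂ U (Strip r)) : Continuous fun t : ℝ => U t :=
  hU.continuousOn.comp_continuous Complex.continuous_ofReal (ofReal_mem_strip hr)

lemma hasDerivAt_comp_ofReal_strip {r : ℝ} (hr : 0 < r) {U : ℂ → ℂ}
    (hU : DifferentiableOn ℂ U (Strip r)) (t : ℝ) :
    HasDerivAt (fun s : ℝ => U s) (deriv U t) t :=
  ((hU.differentiableAt
    ((isOpen_strip r).mem_nhds (ofReal_mem_strip hr t))).hasDerivAt).comp_ofReal

lemma continuous_deriv_comp_ofReal {r : ℝ} (hr : 0 < r) {U : ℂ → ℂ}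
    (hU : DifferentiableOn ℂ U (Strip r)) : Continuous fun t : ℝ => deriv U t :=
  continuous_comp_ofReal hr (hU.deriv (isOpen_strip r))

/-- The change of variables `w = t + U(t)` in the integral of a holomorphic periodic function
of zero mean. -/
lemma integral_one_add_deriv_mul_comp_eq_zero {r R : ℝ} (hr : 0 < r) (hR : 0 < R) {F U : ℂ → ℂ}
    (hFper : ∀ z, F (z + 1) = F z) (hF : DifferentiableOn ℂ F (Strip R))
    (hFmean : (∫ t in (0:ℝ)..1, F t) = 0)
    (hU : DifferentiableOn ℂ U (Strip r)) (hUper : ∀ z, U (z + 1) = U z)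
    (hUR : ∀ t : ℝ, U t ∈ Strip R) :
    (∫ t in (0:ℝ)..1, (1 + deriv U t) * F (t + U t)) = 0 := by
  obtain ⟨G, hG⟩ := (convex_strip R).exists_forall_hasDerivWithinAt hF
  have hG' : ∀ z ∈ Strip R, HasDerivAt G (F z) z := fun z hz =>
    (hG z hz).hasDerivAt ((isOpen_strip R).mem_nhds hz)
  have hadd : ∀ z ∈ Strip R, ∀ t : ℝ, (t : ℂ) + z ∈ Strip R := fun z hz t => by
    simpa [Strip] using hz
  have hshift : ∀ z ∈ Strip R, HasDerivAt (fun z => G (z + 1) - G z) 0 z := fun z hz => by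
    have h1 : HasDerivAt (fun z => G (z + 1)) (F (z + 1)) z :=
      (hG' (z + 1) (by simpa [Strip] using hz)).comp_add_const z 1
    have h2 := h1.sub (hG' z hz)
    rw [hFper, sub_self] at h2
    exact h2
  have hzero : (0 : ℂ) ∈ Strip R := by simpa [Strip] using hR
  have hG01 : G 1 - G 0 = 0 := by
    have h := intervalIntegral.integral_eq_sub_of_hasDerivAt (a := 0) (b := 1)
      (f := fun t : ℝ => G t) (fun t _ => (hG' t (ofReal_mem_strip hR t)).comp_ofReal)
      ((continuous_comp_ofReal hR hF).intervalIntegrable _ _)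
    simpa [hFmean] using h.symm
  have hGper : ∀ z ∈ Strip R, G (z + 1) - G z = 0 := fun z hz => by
    have := (convex_strip R).is_const_of_fderivWithin_eq_zero (𝕜 := ℂ)
      (f := fun z => G (z + 1) - G z)
      (fun z hz => (hshift z hz).differentiableAt.differentiableWithinAt)
      (fun z hz => by
        rw [fderivWithin_of_isOpen (isOpen_strip R) hz]
        ext
        simpa using (hshift z hz).deriv) hz hzero
    simp only [zero_add] at this
    rw [this, hG01]
  have hderiv : ∀ t : ℝ, HasDerivAt (fun s : ℝ => G (s + U s))
      ((1 + deriv U t) * F (t + U t)) t := fun t => by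
    have h1 : HasDerivAt (fun s : ℝ => (s : ℂ) + U s) (1 + deriv U t) t :=
      (hasDerivAt_id t).ofReal_comp.add (hasDerivAt_comp_ofReal_strip hr hU t)
    rw [mul_comm]
    exact (hG' _ (hadd _ (hUR t) t)).comp t h1
  have hcont : Continuous fun t : ℝ => (1 + deriv U t) * F (t + U t) := by
    refine (continuous_const.add (continuous_deriv_comp_ofReal hr hU)).mul ?_
    exact hF.continuousOn.comp_continuous
      (Complex.continuous_ofReal.add (continuous_comp_ofReal hr hU)) fun t => hadd _ (hUR t) t
  rw [intervalIntegral.integral_eq_sub_of_hasDerivAt (fun t _ => hderiv t)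
    (hcont.intervalIntegrable _ _)]
  have h10 : U 1 = U 0 := by simpa using hUper 0
  have := hGper (U 0) (by simpa using hUR 0)
  simpa [h10, add_comm] using this

/-- The `k`-th Fourier coefficient of a function on `ℝ ⊂ ℂ`. -/
def fourierC (U : ℂ → ℂ) (k : ℤ) : ℂ :=
  ∫ t in (0:ℝ)..1, U t * Complex.exp (-(2 * Real.pi * Complex.I * k * t))

lemma hasDerivAt_ek (k : ℤ) (t : ℝ) :
    HasDerivAt (fun s : ℝ => ek k s) (2 * Real.pi * Complex.I * k * ek k t) t := by
  have h : HasDerivAt (fun z : ℂ => 2 * Real.pi * Complex.I * k * z)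
      (2 * Real.pi * Complex.I * k) (t : ℂ) := by
    simpa using (hasDerivAt_id (t : ℂ)).const_mul (2 * Real.pi * Complex.I * k)
  simpa [ek, mul_comm] using h.cexp.comp_ofReal

lemma continuous_ek (k : ℤ) : Continuous fun t : ℝ => ek k t := by
  unfold ek
  fun_prop

lemma norm_ek_ofReal (k : ℤ) (t : ℝ) : ‖ek k t‖ = 1 := by
  simp [ek, Complex.norm_exp]

lemma ek_one (k : ℤ) : ek k 1 = 1 := by
  rw [ek, Complex.exp_eq_one_iff]
  exact ⟨k, by ring⟩

lemma ek_zero_right (k : ℤ) : ek k 0 = 1 := by simp [ek]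

lemma integral_ek (k : ℤ) : (∫ t in (0:ℝ)..1, ek k t) = if k = 0 then 1 else 0 := by
  split_ifs with hk
  · simp [hk, ek]
  · have hc : (2 * Real.pi * Complex.I * k : ℂ) ≠ 0 := by
      simp [hk, Real.pi_ne_zero]
    have h := intervalIntegral.integral_eq_sub_of_hasDerivAt (a := 0) (b := 1)
      (fun t _ => hasDerivAt_ek k t)
      ((continuous_const.mul (continuous_ek k)).intervalIntegrable _ _)
    rw [intervalIntegral.integral_const_mul] at h
    simpa [ek_one, ek_zero_right, hk, Real.pi_ne_zero] using h

lemma integral_deriv_mul_ek {r : ℝ} (hr : 0 < r) {U : ℂ → ℂ}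
    (hU : DifferentiableOn ℂ U (Strip r)) (hUper : ∀ z, U (z + 1) = U z) (k : ℤ) :
    (∫ t in (0:ℝ)..1, (1 + deriv U t) * ek k t) =
      (if k = 0 then 1 else 0) - 2 * Real.pi * Complex.I * k * fourierC U (-k) := by
  have hd := continuous_deriv_comp_ofReal hr hU
  have hk := continuous_ek k
  have h10 : U 1 = U 0 := by simpa using hUper 0
  have hparts := intervalIntegral.integral_mul_deriv_eq_deriv_mul (a := 0) (b := 1)
    (fun t _ => hasDerivAt_comp_ofReal_strip hr hU t) (fun t _ => hasDerivAt_ek k t)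
    (hd.intervalIntegrable _ _) ((continuous_const.mul hk).intervalIntegrable _ _)
  have hF : fourierC U (-k) = ∫ t in (0:ℝ)..1, U t * ek k t := by
    simp [fourierC, ek]
  have hF' : (∫ t in (0:ℝ)..1, U t * (2 * Real.pi * Complex.I * k * ek k t)) =
      2 * Real.pi * Complex.I * k * fourierC U (-k) := by
    rw [hF, ← intervalIntegral.integral_const_mul]
    congr 1
    ext t
    ring
  rw [hF'] at hparts
  simp only [add_mul, one_mul]
  have hdk : Continuous fun t : ℝ => deriv U t * ek k t := hd.mul hk
  rw [intervalIntegral.integral_add (hk.intervalIntegrable _ _) (hdk.intervalIntegrable _ _),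
    integral_ek]
  simp [ek_one, ek_zero_right, h10] at hparts
  rw [hparts]
  ring

/-- Termwise integration of `(1 + U') P` for `P` with an absolutely convergent Fourier series. -/
lemma hasSum_integral_one_add_deriv_mul {r : ℝ} (hr : 0 < r) {U P : ℂ → ℂ}
    (hU : DifferentiableOn ℂ U (Strip r)) (hUper : ∀ z, U (z + 1) = U z) {b : ℤ → ℂ}
    (hP : ∀ t : ℝ, HasSum (fun k : ℤ => b k * ek k t) (P t)) :
    HasSum (fun k : ℤ => b k * ((if k = 0 then 1 else 0) -
        2 * Real.pi * Complex.I * k * fourierC U (-k)))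
      (∫ t in (0:ℝ)..1, (1 + deriv U t) * P t) := by
  have hd := continuous_deriv_comp_ofReal hr hU
  have hb : Summable fun k => ‖b k‖ := by
    simpa [ek_zero_right] using (hP 0).summable.norm
  have h := intervalIntegral.hasSum_integral_of_dominated_convergence
    (μ := MeasureTheory.volume) (a := 0) (b := 1)
    (F := fun (k : ℤ) (t : ℝ) => (1 + deriv U t) * (b k * ek k t))
    (f := fun t : ℝ => (1 + deriv U t) * P t)
    (fun k t => ‖1 + deriv U t‖ * ‖b k‖)
    (fun k => Continuous.aestronglyMeasurable (by have := continuous_ek k; fun_prop))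
    (fun k => Filter.Eventually.of_forall fun t _ => by simp [norm_ek_ofReal])
    (Filter.Eventually.of_forall fun t _ => hb.mul_left _)
    (by
      simp only [tsum_mul_left]
      exact Continuous.intervalIntegrable (by fun_prop) _ _)
    (Filter.Eventually.of_forall fun t _ => (hP t).mul_left _)
  refine h.congr_fun fun k => ?_
  rw [← integral_deriv_mul_ek hr hU hUper, ← intervalIntegral.integral_const_mul]
  congr 1
  ext t
  ring

lemma integral_one_add_deriv_mul_self {r : ℝ} (hr : 0 < r) {U : ℂ → ℂ}
    (hU : DifferentiableOn ℂ U (Strip r)) (hUper : ∀ z, U (z + 1) = U z) :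
    (∫ t in (0:ℝ)..1, (1 + deriv U t) * U t) = fourierC U 0 := by
  have hd := continuous_deriv_comp_ofReal hr hU
  have hc := continuous_comp_ofReal hr hU
  have h10 : U 1 = U 0 := by simpa using hUper 0
  have h := intervalIntegral.integral_eq_sub_of_hasDerivAt (a := 0) (b := 1)
    (fun t _ => (hasDerivAt_comp_ofReal_strip hr hU t).pow 2)
    (((continuous_const.mul (hc.pow _)).mul hd).intervalIntegrable _ _)
  have h2 : (∫ t in (0:ℝ)..1, deriv U t * U t) = 0 := by
    have h3 : (2 : ℂ) * (∫ t in (0:ℝ)..1, deriv U t * U t) = 0 := by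
      rw [← intervalIntegral.integral_const_mul]
      convert h using 1
      · congr 1
        ext t
        simp
        ring
      · simp [h10]
    simpa using h3
  simp only [add_mul, one_mul]
  have hdc : Continuous fun t : ℝ => deriv U t * U t := hd.mul hc
  rw [intervalIntegral.integral_add (hc.intervalIntegrable _ _) (hdc.intervalIntegrable _ _), h2]
  simp [fourierC]

lemma integral_one_add_deriv_mul_second_difference {r : ℝ} (hr : 0 < r) {U P Q : ℂ → ℂ} {q : ℂ}
    (hU : DifferentiableOn ℂ U (Strip r)) (hUper : ∀ z, U (z + 1) = U z)
    (hPc : DifferentiableOn ℂ P (Strip r)) (hQc : DifferentiableOn ℂ Q (Strip r))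
    (hP : ∀ t : ℝ, HasSum (fun k : ℤ => q ^ k * fourierC U k * ek k t) (P t))
    (hQ : ∀ t : ℝ, HasSum (fun k : ℤ => q ^ (-k) * fourierC U k * ek k t) (Q t)) :
    (∫ t in (0:ℝ)..1, (1 + deriv U t) * (P t - 2 * U t + Q t)) = 0 := by
  have hd := continuous_deriv_comp_ofReal hr hU
  have hcont : ∀ {V : ℂ → ℂ}, DifferentiableOn ℂ V (Strip r) →
      Continuous fun t : ℝ => (1 + deriv U t) * V t := fun hV =>
    (continuous_const.add hd).mul (continuous_comp_ofReal hr hV)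
  have hiU := hcont hU
  have hiP := hcont hPc
  have hiQ := hcont hQc
  have h1 := hasSum_integral_one_add_deriv_mul hr hU hUper hP
  have h2 := hasSum_integral_one_add_deriv_mul hr hU hUper hQ
  have h3 := h1.add ((Equiv.neg ℤ).hasSum_iff.mpr h2)
  have h4 : HasSum (fun k : ℤ => if k = 0 then 2 * fourierC U 0 else 0) (2 * fourierC U 0) :=
    hasSum_ite_eq 0 _
  have h5 := h3.unique (h4.congr_fun ?_)
  · have h6 : (∫ t in (0:ℝ)..1, (1 + deriv U t) * (P t - 2 * U t + Q t)) =
        (∫ t in (0:ℝ)..1, (1 + deriv U t) * P t) + (∫ t in (0:ℝ)..1, (1 + deriv U t) * Q t)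
          - 2 * ∫ t in (0:ℝ)..1, (1 + deriv U t) * U t := by
      rw [← intervalIntegral.integral_const_mul, ← intervalIntegral.integral_add,
        ← intervalIntegral.integral_sub]
      · congr 1
        ext t
        ring
      exacts [(hiP.add hiQ).intervalIntegrable _ _,
        (continuous_const.mul hiU).intervalIntegrable _ _,
        hiP.intervalIntegrable _ _, hiQ.intervalIntegrable _ _]
    rw [h6, h5, integral_one_add_deriv_mul_self hr hU hUper, sub_self]
  · intro k
    simp only [Function.comp_apply, Equiv.neg_apply, neg_neg, neg_eq_zero]
    split_ifs with hk
    · subst hk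
      simp
      ring
    · push_cast
      ring

/-- Passing to the limit in the mean value of `(1 + U') V` along uniformly convergent sequences
of bounded holomorphic functions. -/
lemma tendsto_integral_one_add_deriv_mul {r C : ℝ} (hr : 0 < r) {U V : ℕ → ℂ → ℂ} {U₀ V₀ : ℂ → ℂ}
    (hU : ∀ n, DifferentiableOn ℂ (U n) (Strip r)) (hV : ∀ n, DifferentiableOn ℂ (V n) (Strip r))
    (hUb : ∀ n, ∀ z ∈ Strip r, ‖U n z‖ ≤ C) (hVb : ∀ n, ∀ z ∈ Strip r, ‖V n z‖ ≤ C)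
    (hUlim : TendstoUniformlyOn U U₀ Filter.atTop (Strip r))
    (hVlim : TendstoUniformlyOn V V₀ Filter.atTop (Strip r)) :
    Filter.Tendsto (fun n => ∫ t in (0:ℝ)..1, (1 + deriv (U n) t) * V n t) Filter.atTop
      (nhds (∫ t in (0:ℝ)..1, (1 + deriv U₀ t) * V₀ t)) := by
  have hderiv := hUlim.tendstoLocallyUniformlyOn.deriv (Filter.Eventually.of_forall hU)
    (isOpen_strip r)
  have hsub : ∀ t : ℝ, closedBall (t : ℂ) (r / 2) ⊆ Strip r := fun t z hz => by
    have h1 := Complex.abs_im_le_norm (z - t)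
    rw [mem_closedBall, dist_eq_norm] at hz
    simp only [Complex.sub_im, Complex.ofReal_im, sub_zero] at h1
    simp only [Strip, mem_ofPred_eq]
    linarith
  have hbound : ∀ n, ∀ t : ℝ, ‖deriv (U n) t‖ ≤ C / (r / 2) := fun n t =>
    Complex.norm_deriv_le_of_forall_mem_sphere_norm_le (half_pos hr)
      ((hU n).diffContOnCl_ball (hsub t))
      fun z hz => hUb n z (hsub t (sphere_subset_closedBall hz))
  refine intervalIntegral.tendsto_integral_filter_of_dominated_convergence
    (fun _ => (1 + C / (r / 2)) * C) (Filter.Eventually.of_forall fun n => ?_)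
    (Filter.Eventually.of_forall fun n => Filter.Eventually.of_forall fun t _ => ?_)
    (continuous_const.intervalIntegrable _ _) (Filter.Eventually.of_forall fun t _ => ?_)
  · exact ((continuous_const.add (continuous_deriv_comp_ofReal hr (hU n))).mul
      (continuous_comp_ofReal hr (hV n))).aestronglyMeasurable
  · rw [norm_mul]
    have h1 : ‖1 + deriv (U n) t‖ ≤ 1 + C / (r / 2) :=
      (norm_add_le _ _).trans (by simpa using hbound n t)
    exact mul_le_mul h1 (hVb n _ (ofReal_mem_strip hr t)) (norm_nonneg _)
      ((norm_nonneg _).trans h1)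
  · exact ((hderiv.tendsto_at (ofReal_mem_strip hr t)).const_add 1).mul
      (hVlim.tendsto_at (ofReal_mem_strip hr t))

/-- The intervals removed from `[0, 1]` around the rationals of denominator `m`. -/
lemma volume_near_rationals_le {m : ℕ} (hm : 0 < m) {δ : ℝ} (hδ : 0 ≤ δ) (hδm : δ * m ≤ 1) :
    MeasureTheory.volume {x : ℝ | x ∈ Icc (0:ℝ) 1 ∧ ∃ n : ℤ, |x - n / m| < δ} ≤
      ENNReal.ofReal (2 * δ * m) := by
  have hm' : (0 : ℝ) < m := by exact_mod_cast hm
  have hcover : {x : ℝ | x ∈ Icc (0:ℝ) 1 ∧ ∃ n : ℤ, |x - n / m| < δ} ⊆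
      (Icc 0 δ ∪ Icc (1 - δ) 1) ∪
        ⋃ n ∈ Finset.Ico 1 m, Ioo ((n : ℝ) / m - δ) ((n : ℝ) / m + δ) := by
    rintro x ⟨⟨hx0, hx1⟩, n, hn⟩
    rw [abs_lt] at hn
    have hδ' : δ ≤ 1 / m := by rwa [le_div_iff₀ hm']
    rcases lt_trichotomy n 0 with h | h | h
    · exfalso
      have h1 : (n : ℝ) ≤ -1 := by exact_mod_cast Int.le_sub_one_of_lt h
      have h2 : (n : ℝ) / m ≤ -1 / m := by gcongr
      rw [neg_div] at h2
      linarith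
    · left; left
      subst h
      simp at hn
      exact ⟨hx0, hn.2.le⟩
    · rcases lt_trichotomy n m with h' | h' | h'
      · right
        lift n to ℕ using h.le
        simp only [Finset.mem_Ico, mem_iUnion]
        refine ⟨n, ⟨by omega, by omega⟩, ?_, ?_⟩ <;> push_cast at hn <;> linarith
      · left; right
        subst h'
        simp [hm'.ne'] at hn
        exact ⟨by linarith, hx1⟩
      · exfalso
        have h1 : (m : ℝ) + 1 ≤ n := by exact_mod_cast h'
        have h2 : ((m : ℝ) + 1) / m ≤ n / m := by gcongr
        rw [add_div, div_self hm'.ne'] at h2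
        linarith
  refine (MeasureTheory.measure_mono hcover).trans ?_
  refine (MeasureTheory.measure_union_le _ _).trans ?_
  refine (add_le_add (MeasureTheory.measure_union_le _ _)
    (MeasureTheory.measure_biUnion_finset_le _ _)).trans ?_
  have hlen : ∀ c : ℝ, c + δ - (c - δ) = 2 * δ := fun c => by ring
  simp only [Real.volume_Icc, Real.volume_Ioo, hlen, Finset.sum_const, Nat.card_Ico]
  have hm1 : (0 : ℝ) ≤ (m - 1 : ℕ) := Nat.cast_nonneg _
  rw [← ENNReal.ofReal_add (by linarith) (by linarith), ← ENNReal.ofReal_nsmul,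
    ← ENNReal.ofReal_add (by linarith) (by positivity)]
  apply ENNReal.ofReal_le_ofReal
  rw [nsmul_eq_mul, Nat.cast_sub hm]
  push_cast
  linarith

lemma summable_zetaR {s : ℝ} (hs : 1 < s) : Summable fun n : ℕ => 1 / (n + 1 : ℝ) ^ s := by
  have h := (summable_nat_add_iff 1).mpr (Real.summable_one_div_nat_rpow.mpr hs)
  simpa using h

lemma one_le_zetaR {s : ℝ} (hs : 1 < s) : 1 ≤ zetaR s := by
  have h := (summable_zetaR hs).le_tsum 0 (fun n _ => by positivity)
  simpa [zetaR] using h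

lemma AMR_nonempty {τ M : ℝ} (hτ : 0 < τ) (hM : 2 * zetaR (1 + τ) < M) : (AMR τ M).Nonempty := by
  have hs : 1 < 1 + τ := by linarith
  have hζ := one_le_zetaR hs
  have hM0 : 0 < M := by linarith
  by_contra hempty
  rw [Set.not_nonempty_iff_eq_empty] at hempty
  have hcover : Icc (0:ℝ) 1 ⊆ ⋃ k : ℕ, {x : ℝ | x ∈ Icc (0:ℝ) 1 ∧
      ∃ n : ℤ, |x - n / (k + 1 : ℕ)| < 1 / (M * ((k + 1 : ℕ) : ℝ) ^ (2 + τ))} := by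
    intro x hx
    have hx' : x ∉ AMR τ M := by simp [hempty]
    simp only [AMR, mem_ofPred_eq, not_forall, not_le] at hx'
    obtain ⟨n, m, hm, h⟩ := hx'
    obtain ⟨k, rfl⟩ := Nat.exists_eq_add_of_lt hm
    refine mem_iUnion.mpr ⟨k, hx, n, ?_⟩
    simpa using h
  have hrpow : ∀ k : ℕ, ((k + 1 : ℕ) : ℝ) ^ (2 + τ) = ((k : ℝ) + 1) * ((k : ℝ) + 1) ^ (1 + τ) := by
    intro k
    have hk : (0 : ℝ) < (k : ℝ) + 1 := by positivity
    push_cast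
    rw [show 2 + τ = 1 + (1 + τ) by ring, Real.rpow_add hk, Real.rpow_one]
  have hle : (1 : ENNReal) ≤ ENNReal.ofReal (2 / M * zetaR (1 + τ)) := by
    calc (1 : ENNReal) = MeasureTheory.volume (Icc (0:ℝ) 1) := by simp
      _ ≤ _ := MeasureTheory.measure_mono hcover
      _ ≤ _ := MeasureTheory.measure_iUnion_le _
      _ ≤ ∑' k : ℕ, ENNReal.ofReal (2 / M * (1 / ((k : ℝ) + 1) ^ (1 + τ))) := by
        refine ENNReal.tsum_le_tsum fun k => ?_
        have hk : (0 : ℝ) < (k : ℝ) + 1 := by positivity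
        have hk1 : 1 ≤ ((k : ℝ) + 1) ^ (1 + τ) := Real.one_le_rpow (by simp) (by linarith)
        refine (volume_near_rationals_le k.succ_pos (by positivity) ?_).trans
          (ENNReal.ofReal_le_ofReal (le_of_eq ?_))
        · rw [hrpow]
          push_cast
          rw [div_mul_eq_mul_div, div_le_one (by positivity)]
          nlinarith [mul_le_mul (show (1:ℝ) ≤ M by linarith) hk1 zero_le_one hM0.le]
        · rw [hrpow]
          push_cast
          field_simp
      _ = _ := by
        rw [← ENNReal.ofReal_tsum_of_nonneg (fun k => by positivity)
          ((summable_zetaR hs).mul_left _), tsum_mul_left, zetaR]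
  rw [ENNReal.one_le_ofReal, div_mul_eq_mul_div, le_div_iff₀ hM0] at hle
  linarith

lemma exp_mem_KM {τ M : ℝ} (hτ : 0 < τ) (hM : 2 * zetaR (1 + τ) < M) :
    ∃ Y₀ : ℝ, ∀ Y : ℝ, Y₀ ≤ |Y| → (((Real.exp Y : ℝ) : ℂ) : OnePoint ℂ) ∈ KM τ M := by
  obtain ⟨ω₀, hω₀⟩ := AMR_nonempty hτ hM
  have hpi : 0 < 2 * Real.pi := by positivity
  refine ⟨2 * Real.pi * |ω₀|, fun Y hY => Or.inl ⟨⟨0, -(Y / (2 * Real.pi))⟩,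
    ⟨ω₀, hω₀, ?_⟩, ?_⟩⟩
  · rw [sub_zero, abs_neg, abs_div, abs_of_pos hpi, le_div_iff₀ hpi]
    linarith
  · have hpi' : (Real.pi : ℂ) ≠ 0 := by exact_mod_cast Real.pi_ne_zero
    simp only [Efn, Complex.mk_eq_add_mul_I]
    congr 1
    rw [Complex.ofReal_exp]
    congr 1
    push_cast
    field_simp
    linear_combination -(Y : ℂ) * Complex.I_sq

/-- Sequences of nonzero points of `K_M` tending to zero in the chosen chart. -/
lemma exists_seq_tendsto_zero {τ M : ℝ} (hτ : 0 < τ) (hM : 2 * zetaR (1 + τ) < M) :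
    ∃ x : ℕ → ℝ, (∀ n, x n ≠ 0) ∧ Filter.Tendsto (fun n => (x n : ℂ)) Filter.atTop (nhds 0) ∧
      (∀ n, ((x n : ℂ) : OnePoint ℂ) ∈ KM τ M) ∧
      ∀ n, (((x n : ℂ)⁻¹ : ℂ) : OnePoint ℂ) ∈ KM τ M := by
  obtain ⟨Y₀, hY₀⟩ := exp_mem_KM hτ hM
  refine ⟨fun n => Real.exp (-(|Y₀| + n)), fun n => (Real.exp_pos _).ne', ?_, fun n => hY₀ _ ?_,
    fun n => ?_⟩
  · have h : Filter.Tendsto (fun n : ℕ => Real.exp (-(|Y₀| + n))) Filter.atTop (nhds 0) :=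
      Real.tendsto_exp_neg_atTop_nhds_zero.comp
        (Filter.tendsto_atTop_add_const_left _ _ tendsto_natCast_atTop_atTop)
    exact (Complex.continuous_ofReal.tendsto' 0 0 Complex.ofReal_zero).comp h
  · rw [abs_neg, abs_of_nonneg (by positivity)]
    exact (le_abs_self _).trans (by simp)
  · rw [← Complex.ofReal_inv, ← Real.exp_neg, neg_neg]
    refine hY₀ _ ?_
    rw [abs_of_nonneg (by positivity)]
    exact (le_abs_self _).trans (by simp)

/-- The `θ`-function obtained from a value `v ∈ B_{r,ρ}` by freezing `ε`. -/
lemma ValHol.differentiableOn_slice {r ρ : ℝ} {v : ℂ × ℂ → ℂ} (hv : ValHol r ρ v) {ε : ℂ}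
    (hε : ε ∈ ball (0 : ℂ) ρ) : DifferentiableOn ℂ (fun θ => v (θ, ε)) (Strip r) :=
  hv.2.comp (by fun_prop) fun _ hθ => ⟨hθ, hε⟩

lemma ContSup.tendstoUniformlyOn_slice {K : Set ℂ} {r ρ : ℝ} {w : ℂ → ℂ × ℂ → ℂ}
    (hw : ContSup K (SD r ρ) w) {x : ℕ → ℂ} {x₀ : ℂ} (hx₀ : x₀ ∈ K) (hx : ∀ n, x n ∈ K)
    (hlim : Filter.Tendsto x Filter.atTop (nhds x₀)) {ε : ℂ} (hε : ε ∈ ball (0 : ℂ) ρ) :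
    TendstoUniformlyOn (fun n θ => w (x n) (θ, ε)) (fun θ => w x₀ (θ, ε)) Filter.atTop
      (Strip r) := by
  rw [Metric.tendstoUniformlyOn_iff]
  intro η hη
  obtain ⟨δ, hδ, h⟩ := hw x₀ hx₀ (η / 2) (half_pos hη)
  filter_upwards [hlim (ball_mem_nhds x₀ hδ)] with n hn θ hθ
  rw [dist_comm, dist_eq_norm]
  exact (h (x n) (hx n) hn (θ, ε) ⟨hθ, hε⟩).trans_lt (half_lt_self hη)

lemma integral_second_difference_eq_zero_of_tendsto {K : Set ℂ} {r ρ : ℝ} (hr : 0 < r)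
    {w wp wm : ℂ → ℂ × ℂ → ℂ} (hw : ContSup K (SD r ρ) w) (hwp : ContSup K (SD r ρ) wp)
    (hwm : ContSup K (SD r ρ) wm)
    (hwb : BddAbove {x : ℝ | ∃ q ∈ K, ∃ a ∈ SD r ρ, x = ‖w q a‖})
    (hwpb : BddAbove {x : ℝ | ∃ q ∈ K, ∃ a ∈ SD r ρ, x = ‖wp q a‖})
    (hwmb : BddAbove {x : ℝ | ∃ q ∈ K, ∃ a ∈ SD r ρ, x = ‖wm q a‖})
    (hwv : ∀ q ∈ K, ValHol r ρ (w q)) (hwpv : ∀ q ∈ K, ValHol r ρ (wp q))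
    (hwmv : ∀ q ∈ K, ValHol r ρ (wm q))
    {x : ℕ → ℂ} {x₀ : ℂ} (hx₀ : x₀ ∈ K) (hx : ∀ n, x n ∈ K)
    (hlim : Filter.Tendsto x Filter.atTop (nhds x₀)) {ε : ℂ} (hε : ε ∈ ball (0 : ℂ) ρ)
    (hzero : ∀ n, (∫ t in (0:ℝ)..1, (1 + deriv (fun θ => w (x n) (θ, ε)) t) *
      (wp (x n) (t, ε) - 2 * w (x n) (t, ε) + wm (x n) (t, ε))) = 0) :
    (∫ t in (0:ℝ)..1, (1 + deriv (fun θ => w x₀ (θ, ε)) t) *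
      (wp x₀ (t, ε) - 2 * w x₀ (t, ε) + wm x₀ (t, ε))) = 0 := by
  obtain ⟨C, hC⟩ := hwb
  obtain ⟨Cp, hCp⟩ := hwpb
  obtain ⟨Cm, hCm⟩ := hwmb
  have hU := hw.tendstoUniformlyOn_slice hx₀ hx hlim hε
  have hP := hwp.tendstoUniformlyOn_slice hx₀ hx hlim hε
  have hQ := hwm.tendstoUniformlyOn_slice hx₀ hx hlim hε
  have hbU : ∀ n, ∀ z ∈ Strip r, ‖w (x n) (z, ε)‖ ≤ C := fun n z hz =>
    hC ⟨x n, hx n, (z, ε), ⟨hz, hε⟩, rfl⟩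
  have hbP : ∀ n, ∀ z ∈ Strip r, ‖wp (x n) (z, ε)‖ ≤ Cp := fun n z hz =>
    hCp ⟨x n, hx n, (z, ε), ⟨hz, hε⟩, rfl⟩
  have hbQ : ∀ n, ∀ z ∈ Strip r, ‖wm (x n) (z, ε)‖ ≤ Cm := fun n z hz =>
    hCm ⟨x n, hx n, (z, ε), ⟨hz, hε⟩, rfl⟩
  have hdU := fun n => (hwv _ (hx n)).differentiableOn_slice hε
  have hdP := fun n => (hwpv _ (hx n)).differentiableOn_slice hε
  have hdQ := fun n => (hwmv _ (hx n)).differentiableOn_slice hε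
  have hlimV : TendstoUniformlyOn
      (fun n θ => wp (x n) (θ, ε) - 2 * w (x n) (θ, ε) + wm (x n) (θ, ε))
      (fun θ => wp x₀ (θ, ε) - 2 * w x₀ (θ, ε) + wm x₀ (θ, ε)) Filter.atTop (Strip r) := by
    simp only [two_mul]
    exact (hP.sub (hU.add hU)).add hQ
  have h := tendsto_integral_one_add_deriv_mul (C := max C (Cp + 2 * C + Cm)) hr hdU
    (fun n => ((hdP n).sub ((hdU n).const_mul 2)).add (hdQ n))
    (fun n z hz => (hbU n z hz).trans (le_max_left _ _))
    (fun n z hz => ?_) hU hlimV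
  · exact tendsto_nhds_unique h (tendsto_const_nhds.congr fun n => (hzero n).symm)
  · refine le_max_of_le_right ((norm_add_le _ _).trans
      (add_le_add ((norm_sub_le _ _).trans (add_le_add (hbP n z hz) ?_)) (hbQ n z hz)))
    rw [norm_mul, Complex.norm_ofNat]
    linarith [hbU n z hz]

lemma sphChart_of_ne_zero {ξ : ℂ} (hξ : ξ ≠ 0) : sphChart ξ = ((ξ⁻¹ : ℂ) : OnePoint ℂ) :=
  if_neg hξ

lemma sphChart_zero : sphChart 0 = ∞ := if_pos rfl

lemma fn0_le_fNorm {α B : Type*} [NormedAddCommGroup B] [NormedSpace ℂ B] (K : Set ℂ)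
    (S : Set α) (u g : ℂ → α → B) : fn0 K S u ≤ fNorm K S u g := by
  have h0 : 0 ≤ fn0 K S g := Real.sSup_nonneg fun x ⟨_, _, _, _, h⟩ => h ▸ norm_nonneg _
  have h2 : 0 ≤ fn2 K S u g := Real.sSup_nonneg fun x ⟨_, _, _, _, h⟩ => h ▸ norm_nonneg _
  have := le_max_left (fn0 K S g) (fdel K S u)
  unfold fNorm
  linarith

/-- The sup norm of each value is dominated by the `C¹`-holomorphic norm. -/
lemma norm_le_CNorm {τ M r ρ : ℝ} {u : OnePoint ℂ → ℂ × ℂ → ℂ} {g h : ℂ → ℂ × ℂ → ℂ}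
    (hu : MemC τ M r ρ u g h) {q : OnePoint ℂ} (hq : q ∈ KM τ M) {a : ℂ × ℂ} (ha : a ∈ SD r ρ) :
    ‖u q a‖ ≤ CNorm τ M r ρ u g h := by
  obtain ⟨-, ⟨hb₁, hb₂⟩, -⟩ := hu
  induction q using OnePoint.rec with
  | infty =>
    refine le_trans ?_ ((fn0_le_fNorm _ _ _ _).trans (le_max_right _ _))
    exact le_csSup hb₂.1 ⟨0, by simpa [infPart, sphChart_zero] using hq, a, ha, by
      simp only [sphChart_zero]⟩
  | coe z =>
    refine le_trans ?_ ((fn0_le_fNorm _ _ _ _).trans (le_max_left _ _))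
    exact le_csSup hb₁.1 ⟨z, hq, a, ha, rfl⟩

lemma integral_second_difference_eq_zero {τ M ρ r : ℝ} (hτ : 0 < τ)
    (hM : 2 * zetaR (1 + τ) < M) (hr : 0 < r) {u up um : OnePoint ℂ → ℂ × ℂ → ℂ}
    (hu : InC τ M r ρ u) (hup : InC τ M r ρ up) (hum : InC τ M r ρ um)
    (hu1 : IsPlus τ M r ρ u up) (hu2 : IsMinus τ M r ρ u um) {q : OnePoint ℂ}
    (hq : q ∈ KM τ M) {ε : ℂ} (hε : ε ∈ ball (0 : ℂ) ρ) :
    (∫ t in (0:ℝ)..1, (1 + deriv (fun θ => u q (θ, ε)) t) *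
      (up q (t, ε) - 2 * u q (t, ε) + um q (t, ε))) = 0 := by
  obtain ⟨g, h, ⟨hs₁, hs₂⟩, ⟨hb₁, hb₂⟩, hv⟩ := hu
  obtain ⟨gp, hp, ⟨hps₁, hps₂⟩, ⟨hpb₁, hpb₂⟩, hpv⟩ := hup
  obtain ⟨gm, hm, ⟨hms₁, hms₂⟩, ⟨hmb₁, hmb₂⟩, hmv⟩ := hum
  have hgen : ∀ z : ℂ, (z : OnePoint ℂ) ∈ KM τ M → z ≠ 0 →
      (∫ t in (0:ℝ)..1, (1 + deriv (fun θ => u z (θ, ε)) t) *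
        (up z (t, ε) - 2 * u z (t, ε) + um z (t, ε))) = 0 := fun z hz hz0 =>
    integral_one_add_deriv_mul_second_difference hr ((hv _ hz).differentiableOn_slice hε)
      (fun θ => (hv _ hz).1 θ ε) ((hpv _ hz).differentiableOn_slice hε)
      ((hmv _ hz).differentiableOn_slice hε)
      (fun t => hu1 z hz hz0 t (ofReal_mem_strip hr t) ε hε)
      (fun t => hu2 z hz hz0 t (ofReal_mem_strip hr t) ε hε)
  obtain ⟨x, hx0, hxlim, hx, hxinv⟩ := exists_seq_tendsto_zero hτ hM
  have hx0' : ∀ n, (x n : ℂ) ≠ 0 := fun n => by exact_mod_cast hx0 n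
  induction q using OnePoint.rec with
  | infty =>
    have key := integral_second_difference_eq_zero_of_tendsto hr hs₂.1 hps₂.1 hms₂.1 hb₂.1 hpb₂.1
      hmb₂.1 (fun ξ hξ => hv _ hξ) (fun ξ hξ => hpv _ hξ) (fun ξ hξ => hmv _ hξ)
      (x := fun n => (x n : ℂ)) (x₀ := 0) (by simpa [infPart, sphChart_zero] using hq)
      (fun n => by simpa [infPart, sphChart_of_ne_zero (hx0' n)] using hxinv n) hxlim hε
      (fun n => by
        rw [sphChart_of_ne_zero (hx0' n)]
        exact hgen _ (hxinv n) (inv_ne_zero (hx0' n)))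
    simpa only [sphChart_zero] using key
  | coe z =>
    rcases eq_or_ne z 0 with rfl | hz0
    · exact integral_second_difference_eq_zero_of_tendsto hr hs₁.1 hps₁.1 hms₁.1 hb₁.1 hpb₁.1
        hmb₁.1 (fun ξ hξ => hv _ hξ) (fun ξ hξ => hpv _ hξ) (fun ξ hξ => hmv _ hξ)
        (x := fun n => (x n : ℂ)) (x₀ := 0) hq hx hxlim hε
        (fun n => hgen _ (hx n) (hx0' n))
    · exact hgen z hq hz0

/-- Let `f ∈ H^∞(S_{R₀})` have zero mean value and let
`u ∈ C^±_r` satisfy `‖u‖_r < R₀ − r`, so that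
`E(u) = −Δu + ε f∘(id+u) ∈ C_r` is well defined. With `A = 1 + ∂_θu`, the mean
value `⟨A·E(u)⟩` (0-th Fourier coefficient in `θ`) vanishes identically on
`K_M × D_ρ`. -/
theorem mean_value_of_A_times_error_vanishes (τ M ρ r R₀ : ℝ) (hτ : 0 < τ)
    (hM : 2 * zetaR (1 + τ) < M) (hρ : 0 < ρ) (hr : 0 < r) (hrR : r < R₀)
    (F : ℂ → ℂ)
    (hFper : ∀ z : ℂ, F (z + 1) = F z)
    (hFdiff : DifferentiableOn ℂ F (Strip R₀))
    (hFbdd : ∃ C : ℝ, ∀ z ∈ Strip R₀, ‖F z‖ ≤ C)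
    (hFmean : (∫ t in (0:ℝ)..1, F t) = 0)
    (u up um : OnePoint ℂ → ℂ × ℂ → ℂ) (g h : ℂ → ℂ × ℂ → ℂ)
    (hu : MemC τ M r ρ u g h)
    (hup : InC τ M r ρ up) (hum : InC τ M r ρ um)
    (hu1 : IsPlus τ M r ρ u up) (hu2 : IsMinus τ M r ρ u um)
    (husmall : CNorm τ M r ρ u g h < R₀ - r) :
    ∀ q ∈ KM τ M, ∀ ε ∈ Metric.ball (0 : ℂ) ρ,
      (∫ t in (0:ℝ)..1,
        (1 + dth u q ((t : ℂ), ε)) *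
          (-(up q ((t : ℂ), ε) - 2 * u q ((t : ℂ), ε) + um q ((t : ℂ), ε)) +
            ε * F ((t : ℂ) + u q ((t : ℂ), ε)))) = 0 := by
  intro q hq ε hε
  have hR : 0 < R₀ := hr.trans hrR
  have hval := hu.2.2 q hq
  have hU := hval.differentiableOn_slice hε
  have hUR : ∀ t : ℝ, u q (t, ε) ∈ Strip R₀ := fun t => by
    have h1 := norm_le_CNorm hu hq (a := (t, ε)) ⟨ofReal_mem_strip hr t, hε⟩
    have h2 := Complex.abs_im_le_norm (u q (t, ε))
    simp only [Strip, mem_ofPred_eq]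
    linarith
  have hforce := integral_one_add_deriv_mul_comp_eq_zero hr hR hFper hFdiff hFmean hU
    (fun θ => hval.1 θ ε) hUR
  have hdiff := integral_second_difference_eq_zero hτ hM hr ⟨g, h, hu⟩ hup hum hu1 hu2 hq hε
  obtain ⟨gp, hp, -, -, hpv⟩ := hup
  obtain ⟨gm, hm, -, -, hmv⟩ := hum
  have hA : Continuous fun t : ℝ => 1 + deriv (fun θ => u q (θ, ε)) t :=
    continuous_const.add (continuous_deriv_comp_ofReal hr hU)
  have hUc := continuous_comp_ofReal hr hU
  have hPc := continuous_comp_ofReal hr ((hpv q hq).differentiableOn_slice hε)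
  have hQc := continuous_comp_ofReal hr ((hmv q hq).differentiableOn_slice hε)
  have hFc : Continuous fun t : ℝ => F (t + u q (t, ε)) :=
    hFdiff.continuousOn.comp_continuous (Complex.continuous_ofReal.add hUc) fun t => by
      simpa [Strip] using hUR t
  have hsplit : (∫ t in (0:ℝ)..1, (1 + dth u q ((t : ℂ), ε)) *
      (-(up q ((t : ℂ), ε) - 2 * u q ((t : ℂ), ε) + um q ((t : ℂ), ε)) +
        ε * F ((t : ℂ) + u q ((t : ℂ), ε)))) =
      ε * (∫ t in (0:ℝ)..1, (1 + deriv (fun θ => u q (θ, ε)) t) * F (t + u q (t, ε))) -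
        ∫ t in (0:ℝ)..1, (1 + deriv (fun θ => u q (θ, ε)) t) *
          (up q (t, ε) - 2 * u q (t, ε) + um q (t, ε)) := by
    rw [← intervalIntegral.integral_const_mul, ← intervalIntegral.integral_sub]
    · congr 1
      ext t
      simp only [dth]
      ring
    · exact (continuous_const.mul (hA.mul hFc)).intervalIntegrable _ _
    · exact (hA.mul ((hPc.sub (continuous_const.mul hUc)).add hQc)).intervalIntegrable _ _
  rw [hsplit, hforce, hdiff, mul_zero, sub_zero]
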